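/- arXiv:0801.1568 — 2 statements merged into one kernel-verified Lean document; each statement's English description precedes it below -/
import Mathlib

section
/- Let L > 0 and let σ : ℝ → ℝ² be a smooth L-periodic curve with ‖σ'(s)‖ = 1 for all s, whose restriction to [0,L) is injective. Let k(s) := σ'(s) ∧ σ''(s). Then there exist four pairwise distinct points s₁, s₂, s₃, s₄ ∈ [0,L) each of which is a local extremum (a local minimum or a local maximum) of k. -/
noncomputable section

/-- The planar wedge product `a ∧ b = a₁b₂ − a₂b₁`. -/
def wedge (a b : EuclideanSpace ℝ (Fin 2)) : ℝ := a 0 * b 1 - a 1 * b 0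

open Set Filter Topology

/-- A continuous function that is not strictly decreasing between a global maximum and a global
minimum has two further local extrema in between. -/
lemma exists_two_isLocalExtr_of_not_strictAntiOn {k : ℝ → ℝ} (hk : Continuous k) {p q : ℝ}
    (hp : ∀ x, k x ≤ k p) (hq : ∀ x, k q ≤ k x) (h : ¬ StrictAntiOn k (Icc p q)) :
    ∃ c d, p < c ∧ c < d ∧ d < q ∧ IsLocalExtr k c ∧ IsLocalExtr k d := by
  have strict : ∀ x y, p ≤ x → x < y → y ≤ q → k x < k y →
      ∃ c d, p < c ∧ c < d ∧ d < q ∧ IsLocalExtr k c ∧ IsLocalExtr k d := by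
    intro x y hpx hxy hyq hlt
    obtain ⟨c, hc, hcmin⟩ := isCompact_Icc.exists_isMinOn
      (nonempty_Icc.2 (hpx.trans hxy.le)) hk.continuousOn
    have hcx : k c ≤ k x := hcmin ⟨hpx, hxy.le⟩
    have hpc : p < c := lt_of_le_of_ne hc.1 fun e => by have := hp y; rw [e] at this; linarith
    have hcy : c < y := lt_of_le_of_ne hc.2 fun e => by rw [e] at hcx; linarith
    obtain ⟨d, hd, hdmax⟩ := isCompact_Icc.exists_isMaxOn
      (nonempty_Icc.2 (hcy.le.trans hyq)) hk.continuousOn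
    have hdy : k y ≤ k d := hdmax ⟨hcy.le, hyq⟩
    have hcd : c < d := lt_of_le_of_ne hd.1 fun e => by rw [e] at hcx; linarith
    have hdq : d < q := lt_of_le_of_ne hd.2 fun e => by have := hq c; rw [← e] at this; linarith
    exact ⟨c, d, hpc, hcd, hdq, .inl (hcmin.isLocalMin (Icc_mem_nhds hpc hcy)),
      .inr (hdmax.isLocalMax (Icc_mem_nhds hcd hdq))⟩
  simp only [StrictAntiOn, not_forall, not_lt] at h
  obtain ⟨x, hx, y, hy, hxy, hle⟩ := h
  rcases hle.lt_or_eq with hlt | heq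
  · exact strict x y hx.1 hxy hy.2 hlt
  by_cases hu : ∃ u ∈ Ioo x y, k u ≠ k x
  · obtain ⟨u, hu, hne⟩ := hu
    rcases hne.lt_or_gt with hlt | hgt
    · exact strict u y (hx.1.trans hu.1.le) hu.2 hy.2 (heq ▸ hlt)
    · exact strict x u hx.1 hu.1 (hu.2.le.trans hy.2) hgt
  · push Not at hu
    have ext : ∀ u ∈ Ioo x y, IsLocalExtr k u := fun u hu' => .inl <| by
      filter_upwards [Ioo_mem_nhds hu'.1 hu'.2] with v hv
      rw [hu u hu', hu v hv]
    have h1 : (2 * x + y) / 3 ∈ Ioo x y := ⟨by linarith, by linarith⟩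
    have h2 : (x + 2 * y) / 3 ∈ Ioo x y := ⟨by linarith, by linarith⟩
    exact ⟨_, _, hx.1.trans_lt h1.1, by linarith, h2.2.trans_le hy.2, ext _ h1, ext _ h2⟩

/-- Translating by a period preserves local extrema. -/
lemma Function.Periodic.isLocalExtr_add_zsmul {k : ℝ → ℝ} {L : ℝ} (hper : Function.Periodic k L)
    (n : ℤ) {x : ℝ} (h : IsLocalExtr k x) : IsLocalExtr k (x + n • L) := by
  have hx : x + n • L - n • L = x := add_sub_cancel_right _ _
  have ht : Tendsto (fun y => y - n • L) (𝓝 (x + n • L)) (𝓝 x) := by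
    conv_rhs => rw [← hx]
    exact (continuous_sub_right _).tendsto _
  have key : ∀ y, k (y - n • L) = k y := fun y => hper.sub_zsmul_eq n
  have hkx : k (x + n • L) = k x := by rw [← key, hx]
  rcases h with h | h
  · refine .inl ((ht.eventually h).mono fun y hy => ?_)
    rwa [key, ← hkx] at hy
  · refine .inr ((ht.eventually h).mono fun y hy => ?_)
    rwa [key, ← hkx] at hy

/-- A function is injective on every half-open period as soon as it is on one of them. -/
lemma Function.Periodic.injOn_Ico {α : Type*} {f : ℝ → α} {L : ℝ} (hper : Function.Periodic f L)
    (hL : 0 < L) (hinj : InjOn f (Ico 0 L)) (p : ℝ) : InjOn f (Ico p (p + L)) := by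
  intro x hx y hy hxy
  have hmod : ∀ u, f (toIcoMod hL 0 u) = f u := fun u => by
    rw [← self_sub_toIcoDiv_zsmul]; exact hper.sub_zsmul_eq _
  have h := hinj (toIcoMod_mem_Ico' hL x) (toIcoMod_mem_Ico' hL y) (by rw [hmod, hmod, hxy])
  have h' := (toIcoMod_inj hL).1 h
  rw [← (toIcoMod_eq_self hL).2 hx, ← (toIcoMod_eq_self hL).2 hy]
  exact h'.toIcoMod_eq_toIcoMod hL

/-- Four local extrema within one period of a periodic function yield four of them in `[0, L)`. -/
lemma exists_four_isLocalExtr_Ico {k : ℝ → ℝ} {L : ℝ} (hL : 0 < L)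
    (hper : Function.Periodic k L) {a b c d : ℝ} (hab : a < b) (hbc : b < c) (hcd : c < d)
    (hda : d < a + L) (ha : IsLocalExtr k a) (hb : IsLocalExtr k b) (hc : IsLocalExtr k c)
    (hd : IsLocalExtr k d) :
    ∃ s₁ s₂ s₃ s₄ : ℝ,
      s₁ ∈ Ico 0 L ∧ s₂ ∈ Ico 0 L ∧ s₃ ∈ Ico 0 L ∧ s₄ ∈ Ico 0 L ∧
      s₁ ≠ s₂ ∧ s₁ ≠ s₃ ∧ s₁ ≠ s₄ ∧ s₂ ≠ s₃ ∧ s₂ ≠ s₄ ∧ s₃ ≠ s₄ ∧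
      IsLocalExtr k s₁ ∧ IsLocalExtr k s₂ ∧ IsLocalExtr k s₃ ∧ IsLocalExtr k s₄ := by
  have ext : ∀ x, IsLocalExtr k x → IsLocalExtr k (toIcoMod hL 0 x) := fun x hx => by
    rw [← self_sub_toIcoDiv_zsmul, sub_eq_add_neg, ← neg_zsmul]
    exact hper.isLocalExtr_add_zsmul _ hx
  have inj : ∀ x ∈ Ico a (a + L), ∀ y ∈ Ico a (a + L), x < y →
      toIcoMod hL 0 x ≠ toIcoMod hL 0 y := fun x hx y hy hxy h => by
    refine hxy.ne ?_
    rw [← (toIcoMod_eq_self hL).2 hx, ← (toIcoMod_eq_self hL).2 hy]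
    exact ((toIcoMod_inj hL).1 h).toIcoMod_eq_toIcoMod hL
  have ma : a ∈ Ico a (a + L) := ⟨le_rfl, by linarith⟩
  have mb : b ∈ Ico a (a + L) := ⟨by linarith, by linarith⟩
  have mc : c ∈ Ico a (a + L) := ⟨by linarith, by linarith⟩
  have md : d ∈ Ico a (a + L) := ⟨by linarith, by linarith⟩
  exact ⟨toIcoMod hL 0 a, toIcoMod hL 0 b, toIcoMod hL 0 c, toIcoMod hL 0 d,
    toIcoMod_mem_Ico' hL _, toIcoMod_mem_Ico' hL _, toIcoMod_mem_Ico' hL _,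
    toIcoMod_mem_Ico' hL _, inj _ ma _ mb hab, inj _ ma _ mc (hab.trans hbc),
    inj _ ma _ md (by linarith), inj _ mb _ mc hbc, inj _ mb _ md (hbc.trans hcd),
    inj _ mc _ md hcd, ext _ ha, ext _ hb, ext _ hc, ext _ hd⟩

/-- A continuous periodic function either has four local extrema in a period, or it is strictly
decreasing and then strictly increasing over a suitable period. -/
lemma exists_four_isLocalExtr_or_strictAntiOn_strictMonoOn {k : ℝ → ℝ} {L : ℝ} (hL : 0 < L)
    (hk : Continuous k) (hper : Function.Periodic k L) :
    (∃ s₁ s₂ s₃ s₄ : ℝ,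
      s₁ ∈ Ico 0 L ∧ s₂ ∈ Ico 0 L ∧ s₃ ∈ Ico 0 L ∧ s₄ ∈ Ico 0 L ∧
      s₁ ≠ s₂ ∧ s₁ ≠ s₃ ∧ s₁ ≠ s₄ ∧ s₂ ≠ s₃ ∧ s₂ ≠ s₄ ∧ s₃ ≠ s₄ ∧
      IsLocalExtr k s₁ ∧ IsLocalExtr k s₂ ∧ IsLocalExtr k s₃ ∧ IsLocalExtr k s₄) ∨
    ∃ p q, p < q ∧ q < p + L ∧ StrictAntiOn k (Icc p q) ∧ StrictMonoOn k (Icc q (p + L)) := by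
  have hne : (Icc 0 L).Nonempty := nonempty_Icc.2 hL.le
  obtain ⟨p, -, hp⟩ := isCompact_Icc.exists_isMaxOn hne hk.continuousOn
  obtain ⟨q₀, -, hq₀⟩ := isCompact_Icc.exists_isMinOn hne hk.continuousOn
  replace hp : ∀ x, k x ≤ k p := fun x => by
    obtain ⟨y, hy, e⟩ := hper.exists_mem_Ico₀ hL x
    exact e ▸ hp ⟨hy.1, hy.2.le⟩
  replace hq₀ : ∀ x, k q₀ ≤ k x := fun x => by
    obtain ⟨y, hy, e⟩ := hper.exists_mem_Ico₀ hL x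
    exact e ▸ hq₀ ⟨hy.1, hy.2.le⟩
  obtain ⟨q, hq, e⟩ := hper.exists_mem_Ico hL q₀ p
  replace hq₀ : ∀ x, k q ≤ k x := fun x => e ▸ hq₀ x
  have hpL : k (p + L) = k p := hper p
  have ep : IsLocalExtr k p := .inr (.of_forall hp)
  have eq : IsLocalExtr k q := .inl (.of_forall hq₀)
  rcases hq.1.lt_or_eq with hpq | hpq
  · by_cases hA : StrictAntiOn k (Icc p q)
    · by_cases hB : StrictMonoOn k (Icc q (p + L))
      · exact .inr ⟨p, q, hpq, hq.2, hA, hB⟩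
      · obtain ⟨c, d, h1, h2, h3, hc, hd⟩ := exists_two_isLocalExtr_of_not_strictAntiOn
          (k := fun x => -k x) (p := q) (q := p + L) hk.neg
          (fun x => neg_le_neg (hq₀ x)) (fun x => neg_le_neg (hpL ▸ hp x))
          (fun h => hB fun x hx y hy hxy => neg_lt_neg_iff.1 (h hx hy hxy))
        have hc' := hc.neg
        have hd' := hd.neg
        simp only [neg_neg] at hc' hd'
        exact .inl (exists_four_isLocalExtr_Ico hL hper hpq h1 h2 h3 ep eq hc' hd')
    · obtain ⟨c, d, h1, h2, h3, hc, hd⟩ := exists_two_isLocalExtr_of_not_strictAntiOn hk hp hq₀ hA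
      exact .inl (exists_four_isLocalExtr_Ico hL hper h1 h2 h3 hq.2 ep hc hd eq)
  · have ext : ∀ x, IsLocalExtr k x := fun x =>
      .inl (.of_forall fun y => (hp x).trans (hpq ▸ hq₀ y))
    exact .inl (exists_four_isLocalExtr_Ico (a := 0) (b := L / 4) (c := L / 2) (d := 3 * L / 4)
      hL hper (by linarith) (by linarith) (by linarith) (by linarith)
      (ext _) (ext _) (ext _) (ext _))

/-- `θ` is an argument of the nonzero complex number `w`. -/
def HasArgument (w : ℂ) (θ : ℝ) : Prop := ∃ r : ℝ, 0 < r ∧ w = r * Complex.exp (θ * Complex.I)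

namespace HasArgument

lemma ne_zero {w : ℂ} {θ : ℝ} (h : HasArgument w θ) : w ≠ 0 := by
  obtain ⟨r, hr, rfl⟩ := h
  exact mul_ne_zero (by exact_mod_cast hr.ne') (Complex.exp_ne_zero _)

lemma eq_norm_mul {w : ℂ} {θ : ℝ} (h : HasArgument w θ) :
    w = ‖w‖ * Complex.exp (θ * Complex.I) := by
  obtain ⟨r, hr, rfl⟩ := h
  simp [Complex.norm_exp_ofReal_mul_I, abs_of_pos hr]

lemma of_real_mul {w w' : ℂ} {θ c : ℝ} (h : HasArgument w θ) (hc : 0 < c) (hw : w' = c * w) :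
    HasArgument w' θ := by
  obtain ⟨r, hr, rfl⟩ := h
  exact ⟨c * r, by positivity, by rw [hw]; push_cast; ring⟩

lemma mul {w w' : ℂ} {θ θ' : ℝ} (h : HasArgument w θ) (h' : HasArgument w' θ') :
    HasArgument (w * w') (θ + θ') := by
  obtain ⟨r, hr, rfl⟩ := h
  obtain ⟨r', hr', rfl⟩ := h'
  refine ⟨r * r', by positivity, ?_⟩
  push_cast
  rw [add_mul, Complex.exp_add]
  ring

lemma inv {w : ℂ} {θ : ℝ} (h : HasArgument w θ) : HasArgument w⁻¹ (-θ) := by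
  obtain ⟨r, hr, rfl⟩ := h
  refine ⟨r⁻¹, by positivity, ?_⟩
  push_cast
  rw [neg_mul, Complex.exp_neg, mul_inv]

lemma div {w w' : ℂ} {θ θ' : ℝ} (h : HasArgument w θ) (h' : HasArgument w' θ') :
    HasArgument (w / w') (θ - θ') := by
  rw [div_eq_mul_inv, sub_eq_add_neg]
  exact h.mul h'.inv

lemma add_int_mul_two_pi {w : ℂ} {θ : ℝ} (h : HasArgument w θ) (n : ℤ) :
    HasArgument w (θ + n * (2 * Real.pi)) := by
  obtain ⟨r, hr, rfl⟩ := h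
  refine ⟨r, hr, ?_⟩
  push_cast
  rw [add_mul, mul_assoc, Complex.exp_add, Complex.exp_int_mul_two_pi_mul_I, mul_one]

/-- Arguments of opposite numbers differ by an odd multiple of `π`. -/
lemma exists_eq_of_neg {w : ℂ} {θ θ' : ℝ} (h : HasArgument w θ) (h' : HasArgument (-w) θ') :
    ∃ n : ℤ, θ' = θ + Real.pi + n * (2 * Real.pi) := by
  have e := h.eq_norm_mul
  have e' := h'.eq_norm_mul
  have hn : (‖w‖ : ℂ) ≠ 0 := by exact_mod_cast (norm_pos_iff.2 h.ne_zero).ne'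
  have key : Complex.exp (θ' * Complex.I) = Complex.exp ((θ + Real.pi : ℂ) * Complex.I) := by
    rw [add_mul, Complex.exp_add, Complex.exp_pi_mul_I]
    apply mul_left_cancel₀ hn
    rw [norm_neg] at e'
    rw [← e', mul_neg_one, mul_neg, ← e]
  obtain ⟨n, hn⟩ := Complex.exp_eq_exp_iff_exists_int.1 key
  refine ⟨n, ?_⟩
  have := congrArg Complex.im hn
  simpa using this

/-- A continuous choice of argument along a differentiable curve is differentiable. -/
lemma hasDerivAt {w : ℝ → ℂ} {w' : ℂ} {θ : ℝ → ℝ} {s : ℝ} (hθ : ContinuousAt θ s)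
    (h : ∀ᶠ t in 𝓝 s, HasArgument (w t) (θ t)) (hw : HasDerivAt w w' s) :
    HasDerivAt θ (w' / w s).im s := by
  have hs : HasArgument (w s) (θ s) := h.self_of_nhds
  have hdiv : HasDerivAt (fun t => w t / w s) (w' / w s) s := hw.div_const _
  have hlog : HasDerivAt (fun t => Complex.log (w t / w s)) (w' / w s) s := by
    have := hdiv.clog_real (by simp [div_self hs.ne_zero])
    simpa [div_self hs.ne_zero] using this
  have him : HasDerivAt (fun t => θ s + (Complex.log (w t / w s)).im) (w' / w s).im s :=
    (Complex.imCLM.hasFDerivAt.comp_hasDerivAt s hlog).const_add _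
  refine him.congr_of_eventuallyEq ?_
  have hclose : ∀ᶠ t in 𝓝 s, θ t - θ s ∈ Ioo (-Real.pi) Real.pi := by
    have : Tendsto (fun t => θ t - θ s) (𝓝 s) (𝓝 0) := by
      simpa using hθ.tendsto.sub_const (θ s)
    exact this (Ioo_mem_nhds (by linarith [Real.pi_pos]) Real.pi_pos)
  filter_upwards [h, hclose] with t ht hc
  obtain ⟨r, hr, e⟩ := ht.div hs
  rw [Complex.log_im, e, Complex.arg_real_mul _ hr, Complex.arg_exp_mul_I,
    (toIocMod_eq_self Real.two_pi_pos).2 ⟨hc.1, by linarith [hc.2]⟩]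
  ring

end HasArgument

/-- A continuous nowhere zero complex function on an interval has a continuous argument. -/
lemma exists_continuous_hasArgument {v : ℝ → ℂ} {a b : ℝ} (hab : a ≤ b)
    (hv : ContinuousOn v (Icc a b)) (h0 : ∀ s ∈ Icc a b, v s ≠ 0) :
    ∃ θ : ℝ → ℝ, Continuous θ ∧ ∀ s ∈ Icc a b, HasArgument (v s) (θ s) := by
  have hc : Continuous (fun s => v (projIcc a b hab s)) :=
    (continuousOn_iff_continuous_domRestrict.1 hv).comp continuous_projIcc
  have hsc : IsSimplyConnected (univ : Set ℝ) :=
    have := (convex_univ (𝕜 := ℝ) (E := ℝ)).contractibleSpace univ_nonempty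
    SimplyConnectedSpace.ofContractible (univ : Set ℝ)
  obtain ⟨f, hf, he⟩ := Complex.exists_continuousOn_eqOn_exp_comp (X := ℝ) (U := univ)
    hsc isOpen_univ (g := fun s => v (projIcc a b hab s)) hc.continuousOn (by
      rintro ⟨s, -, hs⟩
      exact h0 _ (projIcc a b hab s).2 hs)
  refine ⟨fun s => (f s).im, Complex.continuous_im.comp (continuousOn_univ.1 hf), fun s hs => ?_⟩
  refine ⟨Real.exp (f s).re, Real.exp_pos _, ?_⟩
  have := he (mem_univ s)
  simp only [Function.comp, projIcc_of_mem hab hs] at this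
  rw [← this, Complex.ofReal_exp, ← Complex.exp_add, Complex.re_add_im]

/-- A strictly increasing continuous function on an interval has a continuous inverse. -/
lemma StrictMonoOn.exists_continuousOn_rightInverse {f : ℝ → ℝ} {a b : ℝ} (hab : a ≤ b)
    (hf : ContinuousOn f (Icc a b)) (hm : StrictMonoOn f (Icc a b)) :
    ∃ g : ℝ → ℝ, ContinuousOn g (Icc (f a) (f b)) ∧
      ∀ y ∈ Icc (f a) (f b), g y ∈ Icc a b ∧ f (g y) = y := by
  have himg : f '' Icc a b = Icc (f a) (f b) := hf.image_Icc_of_monotoneOn hab hm.monotoneOn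
  have : OrdConnected (f '' Icc a b) := himg ▸ ordConnected_Icc
  have hle : f a ≤ f b := hm.monotoneOn (left_mem_Icc.2 hab) (right_mem_Icc.2 hab) hab
  let e := hm.orderIso f (Icc a b)
  have hmem : ∀ y, (projIcc (f a) (f b) hle y : ℝ) ∈ f '' Icc a b := fun y =>
    himg.ge (projIcc (f a) (f b) hle y).2
  refine ⟨fun y => e.symm ⟨projIcc (f a) (f b) hle y, hmem y⟩, Continuous.continuousOn ?_,
    fun y hy => ⟨Subtype.coe_prop _, ?_⟩⟩
  · exact continuous_subtype_val.comp (e.symm.continuous.comp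
      ((continuous_subtype_val.comp continuous_projIcc).subtype_mk hmem))
  · have := congrArg Subtype.val (e.apply_symm_apply ⟨projIcc (f a) (f b) hle y, hmem y⟩)
    simp only [projIcc_of_mem hle hy] at this ⊢
    exact this

/-- If `g` is strictly decreasing and `f' = -c g'` with `c > 0`, then `f` is strictly increasing. -/
lemma strictMonoOn_of_hasDerivAt_neg_mul {f g c g' : ℝ → ℝ} {a b : ℝ}
    (hf : ∀ s, HasDerivAt f (-(c s * g' s)) s) (hg : ∀ s, HasDerivAt g (g' s) s)
    (hc : ∀ s ∈ Ioo a b, 0 < c s) (hanti : StrictAntiOn g (Icc a b)) :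
    StrictMonoOn f (Icc a b) := by
  have hg' : ∀ s ∈ Ioo a b, g' s ≤ 0 := fun s hs => by
    have h := hanti.antitoneOn.derivWithin_nonpos (x := s)
    rwa [derivWithin_of_mem_nhds (Icc_mem_nhds hs.1 hs.2), (hg s).deriv] at h
  have hmono : MonotoneOn f (Icc a b) := by
    refine monotoneOn_of_deriv_nonneg (convex_Icc a b)
      (fun s _ => (hf s).continuousAt.continuousWithinAt)
      (fun s _ => (hf s).differentiableAt.differentiableWithinAt) fun s hs => ?_
    rw [interior_Icc] at hs
    rw [(hf s).deriv]
    nlinarith [hg' s hs, hc s hs]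
  intro s hs t ht hst
  refine lt_of_le_of_ne (hmono hs ht hst.le) fun heq => ?_
  have hsub : Icc s t ⊆ Icc a b := Icc_subset_Icc hs.1 ht.2
  have hconst : ∀ u ∈ Icc s t, f u = f s := fun u hu =>
    le_antisymm (heq ▸ hmono (hsub hu) ht hu.2) (hmono hs (hsub hu) hu.1)
  obtain ⟨u, hu, hslope⟩ := exists_hasDerivAt_eq_slope g g' hst
    (fun u _ => (hg u).continuousAt.continuousWithinAt) fun u _ => hg u
  have hfu : HasDerivAt f 0 u := by
    refine (hasDerivAt_const u (f s)).congr_of_eventuallyEq ?_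
    filter_upwards [Icc_mem_nhds hu.1 hu.2] with v hv using hconst v hv
  have h0 : c u * g' u = 0 := neg_eq_zero.1 ((hf u).unique hfu)
  have hcu := hc u ⟨hs.1.trans_lt hu.1, hu.2.trans_le ht.2⟩
  have hlt : g' u < 0 := by
    rw [hslope]
    exact div_neg_of_neg_of_pos (sub_neg.2 (hanti hs ht hst)) (sub_pos.2 hst)
  nlinarith

/-- The position of the point `P` relative to the osculating circle at `s` of a unit-speed
curve `z` with velocity `T` and curvature `k`: it is positive when `P` lies strictly to the left
of that circle, negative when it lies strictly to the right. -/
def osculatingGap (z T : ℝ → ℂ) (k : ℝ → ℝ) (P : ℂ) (s : ℝ) : ℝ :=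
  (T s * (starRingEnd ℂ) (z s - P)).im - k s * Complex.normSq (z s - P) / 2

lemma hasDerivAt_osculatingGap {z T : ℝ → ℂ} {k k' : ℝ → ℝ} (hz : ∀ s, HasDerivAt z (T s) s)
    (hT : ∀ s, HasDerivAt T (k s * Complex.I * T s) s) (hk : ∀ s, HasDerivAt k (k' s) s)
    (P : ℂ) (s : ℝ) :
    HasDerivAt (osculatingGap z T k P) (-(Complex.normSq (z s - P) / 2 * k' s)) s := by
  have hre : HasDerivAt (fun s => (z s - P).re) (T s).re s :=
    Complex.reCLM.hasFDerivAt.comp_hasDerivAt s ((hz s).sub_const P)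
  have him : HasDerivAt (fun s => (z s - P).im) (T s).im s :=
    Complex.imCLM.hasFDerivAt.comp_hasDerivAt s ((hz s).sub_const P)
  have hTre : HasDerivAt (fun s => (T s).re) (k s * Complex.I * T s).re s :=
    Complex.reCLM.hasFDerivAt.comp_hasDerivAt s (hT s)
  have hTim : HasDerivAt (fun s => (T s).im) (k s * Complex.I * T s).im s :=
    Complex.imCLM.hasFDerivAt.comp_hasDerivAt s (hT s)
  have h := ((hTim.mul hre).sub (hTre.mul him)).sub
    (((hk s).mul ((hre.mul hre).add (him.mul him))).div_const 2)
  refine (h.congr_deriv ?_).congr_of_eventuallyEq (.of_forall fun t => ?_)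
  · simp [Complex.normSq_apply]
    ring
  · simp [osculatingGap, Complex.normSq_apply]
    ring

/-- The angular velocity seen from `P` exceeds half the curvature by a multiple of the gap. -/
lemma im_div_sub_eq {z T : ℝ → ℂ} (k : ℝ → ℝ) {P : ℂ} {s : ℝ} (h : z s ≠ P) :
    (T s / (z s - P)).im = k s / 2 + osculatingGap z T k P s / Complex.normSq (z s - P) := by
  have h0 : Complex.normSq (z s - P) ≠ 0 := by
    simpa [Complex.normSq_eq_zero] using sub_ne_zero.2 h
  rw [div_eq_mul_inv, Complex.inv_def, ← mul_assoc, Complex.im_mul_ofReal, osculatingGap]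
  field_simp
  ring

/-- Along an arc of a regular curve which meets its endpoints only at its ends, the Möbius
coordinate sending these endpoints to `0` and `∞` has a continuous argument up to the ends. -/
lemma exists_continuous_argument_of_arc {z T : ℝ → ℂ} (hz : ∀ s, HasDerivAt z (T s) s)
    (hT : ∀ s, T s ≠ 0) {a b : ℝ} (hab : a < b) (ha : ∀ s ∈ Ioc a b, z s ≠ z a)
    (hb : ∀ s ∈ Ico a b, z s ≠ z b) :
    ∃ θ : ℝ → ℝ, Continuous θ ∧
      (∀ s ∈ Ioo a b, HasArgument ((z s - z a) / (z s - z b)) (θ s)) ∧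
      HasArgument (T a / (z a - z b)) (θ a) ∧ HasArgument ((z a - z b) / T b) (θ b) ∧
      ∀ s ∈ Ioo a b, HasDerivAt θ (T s / (z s - z a) - T s / (z s - z b)).im s := by
  have hcont : ∀ c, Continuous (dslope z c) := fun c => continuous_iff_continuousAt.2 fun s => by
    rcases eq_or_ne s c with rfl | hs
    · exact continuousAt_dslope_same.2 (hz s).differentiableAt
    · exact (continuousAt_dslope_of_ne hs).2 (hz s).continuousAt
  have hslope : ∀ c s, s ≠ c → dslope z c s = ((s - c : ℝ) : ℂ)⁻¹ * (z s - z c) :=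
    fun c s h => by rw [dslope_of_ne _ h, slope_def_module]; simp
  have hne : ∀ c s, (s ≠ c → z s ≠ z c) → dslope z c s ≠ 0 := fun c s h => by
    rcases eq_or_ne s c with rfl | hs
    · rw [dslope_same, (hz s).deriv]; exact hT s
    · rw [hslope c s hs]
      exact mul_ne_zero (inv_ne_zero (by exact_mod_cast sub_ne_zero.2 hs)) (sub_ne_zero.2 (h hs))
  have hna : ∀ s ∈ Icc a b, dslope z a s ≠ 0 := fun s hs =>
    hne a s fun h => ha s ⟨lt_of_le_of_ne hs.1 h.symm, hs.2⟩
  have hnb : ∀ s ∈ Icc a b, dslope z b s ≠ 0 := fun s hs =>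
    hne b s fun h => hb s ⟨hs.1, lt_of_le_of_ne hs.2 h⟩
  obtain ⟨θ, hθ, harg⟩ := exists_continuous_hasArgument (v := fun s => -dslope z a s / dslope z b s)
    hab.le ((hcont a).neg.continuousOn.div (hcont b).continuousOn hnb)
    fun s hs => div_ne_zero (neg_ne_zero.2 (hna s hs)) (hnb s hs)
  have hA : ∀ s ∈ Ioo a b, HasArgument ((z s - z a) / (z s - z b)) (θ s) := fun s hs => by
    have h1 : (0 : ℝ) < s - a := sub_pos.2 hs.1
    have h2 : (0 : ℝ) < b - s := sub_pos.2 hs.2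
    refine (harg s ⟨hs.1.le, hs.2.le⟩).of_real_mul (div_pos h1 h2) ?_
    have e1 : (s - a : ℂ) ≠ 0 := by exact_mod_cast h1.ne'
    have e2 : (b - s : ℂ) ≠ 0 := by exact_mod_cast h2.ne'
    have e3 : (s - b : ℂ) ≠ 0 := by rw [← neg_sub]; exact neg_ne_zero.2 e2
    have e4 : z s - z b ≠ 0 := sub_ne_zero.2 (hb s ⟨hs.1.le, hs.2⟩)
    simp only [hslope a s hs.1.ne', hslope b s hs.2.ne]
    push_cast
    field_simp
    ring
  have hba : (0 : ℝ) < b - a := sub_pos.2 hab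
  have e1 : (b - a : ℂ) ≠ 0 := by exact_mod_cast hba.ne'
  have e2 : (a - b : ℂ) ≠ 0 := by rw [← neg_sub]; exact neg_ne_zero.2 e1
  have e3 : z a - z b ≠ 0 := sub_ne_zero.2 (hb a ⟨le_rfl, hab⟩)
  have e4 := hT b
  refine ⟨θ, hθ, hA, ?_, ?_, fun s hs => ?_⟩
  · refine (harg a ⟨le_rfl, hab.le⟩).of_real_mul (inv_pos.2 hba) ?_
    simp only [dslope_same, (hz a).deriv, hslope b a hab.ne]
    push_cast
    field_simp
    ring
  · refine (harg b ⟨hab.le, le_rfl⟩).of_real_mul hba ?_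
    simp only [dslope_same, (hz b).deriv, hslope a b hab.ne']
    push_cast
    field_simp
    ring
  · have n1 : z s - z a ≠ 0 := sub_ne_zero.2 (ha s ⟨hs.1, hs.2.le⟩)
    have n2 : z s - z b ≠ 0 := sub_ne_zero.2 (hb s ⟨hs.1.le, hs.2⟩)
    have hd := HasArgument.hasDerivAt hθ.continuousAt
      (eventually_of_mem (Ioo_mem_nhds hs.1 hs.2) hA)
      (((hz s).sub_const (z a)).div ((hz s).sub_const (z b)) n2)
    refine hd.congr_deriv (congrArg Complex.im ?_)
    field_simp

/-- A closed regular plane curve whose curvature is strictly decreasing on one arc and strictly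
increasing on the complementary arc is not simple. -/
lemma not_injOn_of_strictAntiOn_strictMonoOn {z T : ℝ → ℂ} {k k' : ℝ → ℝ} {L p q : ℝ}
    (hz : ∀ s, HasDerivAt z (T s) s) (hT : ∀ s, HasDerivAt T (k s * Complex.I * T s) s)
    (hk : ∀ s, HasDerivAt k (k' s) s) (hT0 : ∀ s, T s ≠ 0) (hper : Function.Periodic z L)
    (hTper : Function.Periodic T L)
    (hpq : p < q) (hqL : q < p + L) (hA : StrictAntiOn k (Icc p q))
    (hB : StrictMonoOn k (Icc q (p + L))) : ¬ InjOn z (Ico p (p + L)) := by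
  intro hinj
  have hpL : z (p + L) = z p := hper p
  have hp : ∀ s ∈ Icc p (p + L), z s = z p → s = p ∨ s = p + L := fun s hs h => by
    rcases hs.2.lt_or_eq with hlt | heq
    · exact .inl (hinj ⟨hs.1, hlt⟩ ⟨le_rfl, hpq.trans hqL⟩ h)
    · exact .inr heq
  have hq : ∀ s ∈ Icc p (p + L), z s = z q → s = q := fun s hs h => by
    rcases hs.2.lt_or_eq with hlt | heq
    · exact hinj ⟨hs.1, hlt⟩ ⟨hpq.le, hqL⟩ h
    · rw [heq, hpL] at h
      exact absurd (hinj ⟨le_rfl, hpq.trans hqL⟩ ⟨hpq.le, hqL⟩ h) hpq.ne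
  have hpA : ∀ s ∈ Icc p q, z s = z p → s = p := fun s hs h =>
    (hp s ⟨hs.1, hs.2.trans hqL.le⟩ h).resolve_right (by linarith [hs.2])
  have hqA : ∀ s ∈ Icc p q, z s = z q → s = q := fun s hs =>
    hq s ⟨hs.1, hs.2.trans hqL.le⟩
  have hpB : ∀ s ∈ Icc q (p + L), z s = z p → s = p + L := fun s hs h =>
    (hp s ⟨hpq.le.trans hs.1, hs.2⟩ h).resolve_left (by linarith [hs.1])
  have hqB : ∀ s ∈ Icc q (p + L), z s = z q → s = q := fun s hs =>
    hq s ⟨hpq.le.trans hs.1, hs.2⟩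
  have hPQ : z p ≠ z q := fun h => hpq.ne (hqA p ⟨le_rfl, hpq.le⟩ h)
  have hPQ' : z p - z q ≠ 0 := sub_ne_zero.2 hPQ
  have hgap := fun P => hasDerivAt_osculatingGap hz hT hk P
  have hsq : ∀ {s P}, z s ≠ P → 0 < Complex.normSq (z s - P) := fun h =>
    Complex.normSq_pos.2 (sub_ne_zero.2 h)
  have hgapA : ∀ P, (∀ s ∈ Ioo p q, z s ≠ P) →
      StrictMonoOn (osculatingGap z T k P) (Icc p q) := fun P h =>
    strictMonoOn_of_hasDerivAt_neg_mul (hgap P) hk (fun s hs => half_pos (hsq (h s hs))) hA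
  have hgapB : ∀ P, (∀ s ∈ Ioo q (p + L), z s ≠ P) →
      StrictAntiOn (osculatingGap z T k P) (Icc q (p + L)) := fun P h => by
    have hm : StrictMonoOn (fun s => -osculatingGap z T k P s) (Icc q (p + L)) :=
      strictMonoOn_of_hasDerivAt_neg_mul (g := fun s => -k s) (g' := fun s => -k' s)
        (c := fun s => Complex.normSq (z s - P) / 2)
        (fun s => (hgap P s).neg.congr_deriv (by ring)) (fun s => (hk s).neg)
        (fun s hs => half_pos (hsq (h s hs))) hB.neg
    exact fun x hx y hy hxy => neg_lt_neg_iff.1 (hm hx hy hxy)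
  have hgap0 : ∀ s, osculatingGap z T k (z s) s = 0 := fun s => by simp [osculatingGap]
  have hangle : ∀ s, z s ≠ z p → z s ≠ z q → 0 < osculatingGap z T k (z p) s →
      osculatingGap z T k (z q) s < 0 → 0 < (T s / (z s - z p) - T s / (z s - z q)).im := by
    intro s h1 h2 h3 h4
    rw [Complex.sub_im, im_div_sub_eq k h1, im_div_sub_eq k h2]
    have := div_pos h3 (hsq h1)
    have := div_neg_of_neg_of_pos h4 (hsq h2)
    linarith
  obtain ⟨θA, hθA, argA, argAp, argAq, derA⟩ := exists_continuous_argument_of_arc hz hT0 hpq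
    (fun s hs h => hs.1.ne' (hpA s ⟨hs.1.le, hs.2⟩ h))
    (fun s hs h => hs.2.ne (hqA s ⟨hs.1, hs.2.le⟩ h))
  obtain ⟨θB, hθB, argB, argBq, argBp, derB⟩ := exists_continuous_argument_of_arc hz hT0 hqL
    (fun s hs h => hs.1.ne' (hqB s ⟨hs.1.le, hs.2⟩ h))
    (fun s hs h => hs.2.ne (hpB s ⟨hs.1, hs.2.le⟩ (h.trans hpL)))
  rw [hpL] at argBq argBp
  rw [hTper p] at argBp
  simp only [hpL] at argB derB
  have monoA : StrictMonoOn θA (Icc p q) := by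
    refine strictMonoOn_of_deriv_pos (convex_Icc p q) hθA.continuousOn fun s hs => ?_
    rw [interior_Icc] at hs
    have hs' : s ∈ Icc p q := Ioo_subset_Icc_self hs
    rw [(derA s hs).deriv]
    refine hangle s (fun h => hs.1.ne' (hpA s hs' h)) (fun h => hs.2.ne (hqA s hs' h)) ?_ ?_
    · rw [← hgap0 p]
      exact hgapA _ (fun t ht h => ht.1.ne' (hpA t (Ioo_subset_Icc_self ht) h))
        (left_mem_Icc.2 hpq.le) hs' hs.1
    · rw [← hgap0 q]
      exact hgapA _ (fun t ht h => ht.2.ne (hqA t (Ioo_subset_Icc_self ht) h))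
        hs' (right_mem_Icc.2 hpq.le) hs.2
  obtain ⟨m, hm⟩ := argAp.exists_eq_of_neg
    (θ' := -θB (p + L)) (by
      have h := argBp.inv
      rwa [inv_div, ← neg_sub, div_neg] at h)
  obtain ⟨n, hn⟩ := argAq.exists_eq_of_neg
    (θ' := -θB q) (by
      have h := argBq.inv
      rwa [inv_div, ← neg_sub, neg_div] at h)
  set φ : ℝ → ℝ := fun t => -θB t + (-m : ℤ) * (2 * Real.pi) with hφ
  have φcont : Continuous φ := hθB.neg.add_const _
  have monoB : StrictMonoOn φ (Icc q (p + L)) := by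
    refine strictMonoOn_of_deriv_pos (convex_Icc _ _) φcont.continuousOn fun s hs => ?_
    rw [interior_Icc] at hs
    have hs' : s ∈ Icc q (p + L) := Ioo_subset_Icc_self hs
    have hd : HasDerivAt φ _ s := (derB s hs).neg.add_const _
    rw [hd.deriv, ← Complex.neg_im, neg_sub]
    refine hangle s (fun h => hs.2.ne (hpB s hs' h)) (fun h => hs.1.ne' (hqB s hs' h)) ?_ ?_
    · rw [← hgap0 (p + L), hpL]
      exact hgapB _ (fun t ht h => ht.2.ne (hpB t (Ioo_subset_Icc_self ht) h))
        hs' (right_mem_Icc.2 hqL.le) hs.2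
    · rw [← hgap0 q]
      exact hgapB _ (fun t ht h => ht.1.ne' (hqB t (Ioo_subset_Icc_self ht) h))
        (left_mem_Icc.2 hqL.le) hs' hs.1
  have hα : θA p < θA q := monoA (left_mem_Icc.2 hpq.le) (right_mem_Icc.2 hpq.le) hpq
  have hφB : φ q < φ (p + L) := monoB (left_mem_Icc.2 hqL.le) (right_mem_Icc.2 hqL.le) hqL
  have hφp : φ (p + L) = θA p + Real.pi := by
    simp only [hφ, hm]; push_cast; ring
  have hφq : φ q < θA q := by
    have e : φ q = θA q + Real.pi + (n - m : ℤ) * (2 * Real.pi) := by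
      simp only [hφ, hn]; push_cast; ring
    have hlt : (n - m : ℤ) < 0 := by
      by_contra! h
      have h' : (0 : ℝ) ≤ (n - m : ℤ) := by exact_mod_cast h
      have := mul_nonneg h' Real.two_pi_pos.le
      linarith
    have h' : ((n - m : ℤ) : ℝ) ≤ -1 := by exact_mod_cast Int.le_sub_one_of_lt hlt
    nlinarith [Real.pi_pos]
  have hπ := Real.pi_pos
  obtain ⟨gA, gAc, hgA⟩ := monoA.exists_continuousOn_rightInverse hpq.le hθA.continuousOn
  obtain ⟨gB, gBc, hgB⟩ := monoB.exists_continuousOn_rightInverse hqL.le φcont.continuousOn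
  set lo := max (θA p) (φ q) with hlo
  set hi := min (θA q) (φ (p + L)) with hhi
  have hlohi : lo ≤ hi :=
    max_le (le_min hα.le (by linarith)) (le_min hφq.le hφB.le)
  have subA : Icc lo hi ⊆ Icc (θA p) (θA q) := Icc_subset_Icc (le_max_left _ _) (min_le_left _ _)
  have subB : Icc lo hi ⊆ Icc (φ q) (φ (p + L)) :=
    Icc_subset_Icc (le_max_right _ _) (min_le_right _ _)
  have endA : ∀ y ∈ Icc lo hi, (y = θA p → gA y = p) ∧ (y = θA q → gA y = q) := fun y hy =>
    ⟨fun h => monoA.injOn (hgA y (subA hy)).1 (left_mem_Icc.2 hpq.le) (by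
        rw [(hgA y (subA hy)).2, h]),
      fun h => monoA.injOn (hgA y (subA hy)).1 (right_mem_Icc.2 hpq.le) (by
        rw [(hgA y (subA hy)).2, h])⟩
  have endB : ∀ y ∈ Icc lo hi, (y = φ q → gB y = q) ∧ (y = φ (p + L) → gB y = p + L) := fun y hy =>
    ⟨fun h => monoB.injOn (hgB y (subB hy)).1 (left_mem_Icc.2 hqL.le) (by
        rw [(hgB y (subB hy)).2, h]),
      fun h => monoB.injOn (hgB y (subB hy)).1 (right_mem_Icc.2 hqL.le) (by
        rw [(hgB y (subB hy)).2, h])⟩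
  have zc : Continuous z := continuous_iff_continuousAt.2 fun s => (hz s).continuousAt
  set F : ℝ → ℝ := fun y =>
    ‖z (gA y) - z p‖ * ‖z (gB y) - z q‖ - ‖z (gB y) - z p‖ * ‖z (gA y) - z q‖ with hF
  have Fc : ContinuousOn F (Icc lo hi) := by
    have cA : ContinuousOn (fun y => z (gA y)) (Icc lo hi) := zc.comp_continuousOn (gAc.mono subA)
    have cB : ContinuousOn (fun y => z (gB y)) (Icc lo hi) := zc.comp_continuousOn (gBc.mono subB)
    exact ((cA.sub continuousOn_const).norm.mul (cB.sub continuousOn_const).norm).sub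
      ((cB.sub continuousOn_const).norm.mul (cA.sub continuousOn_const).norm)
  have Flo : F lo ≤ 0 := by
    have hmem : lo ∈ Icc lo hi := left_mem_Icc.2 hlohi
    rcases max_choice (θA p) (φ q) with h | h
    · simp only [hF, (endA lo hmem).1 h, sub_self, norm_zero, zero_mul, zero_sub, neg_nonpos]
      positivity
    · simp only [hF, (endB lo hmem).1 h, sub_self, norm_zero, mul_zero, zero_sub, neg_nonpos]
      positivity
  have Fhi : 0 ≤ F hi := by
    have hmem : hi ∈ Icc lo hi := right_mem_Icc.2 hlohi
    rcases min_choice (θA q) (φ (p + L)) with h | h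
    · simp only [hF, (endA hi hmem).2 h, sub_self, norm_zero, mul_zero, sub_zero]
      positivity
    · simp only [hF, (endB hi hmem).2 h, hpL, sub_self, norm_zero, zero_mul, sub_zero]
      positivity
  obtain ⟨y, hy, hFy⟩ := intermediate_value_Icc hlohi Fc ⟨Flo, Fhi⟩
  obtain ⟨hs, hsy⟩ := hgA y (subA hy)
  obtain ⟨ht, hty⟩ := hgB y (subB hy)
  simp only [hF] at hFy
  generalize gA y = s at *
  generalize gB y = t at *
  have hsp : s ≠ p := by
    rintro rfl
    simp only [sub_self, norm_zero, zero_mul, zero_sub, neg_eq_zero, mul_eq_zero, norm_eq_zero,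
      hPQ', or_false] at hFy
    have := hpB t ht (sub_eq_zero.1 hFy)
    rw [this] at hty
    linarith
  have hsq' : s ≠ q := by
    rintro rfl
    simp only [sub_self, norm_zero, mul_zero, sub_zero, mul_eq_zero, norm_eq_zero,
      sub_ne_zero.2 hPQ.symm, false_or] at hFy
    have := hqB t ht (sub_eq_zero.1 hFy)
    rw [this] at hty
    linarith
  have htq : t ≠ q := by
    rintro rfl
    simp only [sub_self, norm_zero, mul_zero, zero_sub, neg_eq_zero, mul_eq_zero, norm_eq_zero,
      sub_ne_zero.2 hPQ.symm, false_or] at hFy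
    exact hsq' (hqA s hs (sub_eq_zero.1 hFy))
  have htp : t ≠ p + L := by
    rintro rfl
    simp only [hpL, sub_self, norm_zero, zero_mul, sub_zero, mul_eq_zero, norm_eq_zero,
      hPQ', or_false] at hFy
    exact hsp (hpA s hs (sub_eq_zero.1 hFy))
  have hs' : s ∈ Ioo p q := ⟨lt_of_le_of_ne hs.1 hsp.symm, lt_of_le_of_ne hs.2 hsq'⟩
  have ht' : t ∈ Ioo q (p + L) := ⟨lt_of_le_of_ne ht.1 htq.symm, lt_of_le_of_ne ht.2 htp⟩
  have as := (argA s hs').eq_norm_mul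
  have at' := ((argB t ht').inv.add_int_mul_two_pi (-m)).eq_norm_mul
  have hsQ : z s - z q ≠ 0 := sub_ne_zero.2 fun h => hsq' (hqA s hs h)
  have htQ : z t - z q ≠ 0 := sub_ne_zero.2 fun h => htq (hqB t ht h)
  change _ = _ * Complex.exp ((φ t : ℝ) * Complex.I) at at'
  rw [hty, inv_div, norm_div] at at'
  rw [hsy, norm_div] at as
  have hnorm : ‖z s - z p‖ / ‖z s - z q‖ = ‖z t - z p‖ / ‖z t - z q‖ := by
    rw [div_eq_div_iff (norm_ne_zero_iff.2 hsQ) (norm_ne_zero_iff.2 htQ)]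
    linarith
  rw [hnorm, ← at', div_eq_div_iff hsQ htQ] at as
  have hzst : z s = z t := by
    apply mul_left_cancel₀ hPQ'
    linear_combination as
  have := hinj ⟨hs.1, hs.2.trans_lt hqL⟩ ⟨hpq.le.trans ht.1, ht'.2⟩ hzst
  linarith [hs'.2, ht'.1]

/-- four-vertex theorem: a smooth simple closed unit-speed plane curve
(`L`-periodic, injective on `[0,L)`) has at least four pairwise distinct local extrema
of its signed curvature `k(s) = σ'(s) ∧ σ''(s)` in `[0,L)`. -/
theorem four_vertex (L : ℝ) (hL : 0 < L) (σ : ℝ → EuclideanSpace ℝ (Fin 2))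
    (hσ : ContDiff ℝ (⊤ : ℕ∞) σ) (hper : Function.Periodic σ L)
    (hunit : ∀ s, ‖deriv σ s‖ = 1) (hinj : Set.InjOn σ (Set.Ico 0 L)) :
    ∃ s₁ s₂ s₃ s₄ : ℝ,
      s₁ ∈ Set.Ico 0 L ∧ s₂ ∈ Set.Ico 0 L ∧ s₃ ∈ Set.Ico 0 L ∧ s₄ ∈ Set.Ico 0 L ∧
      s₁ ≠ s₂ ∧ s₁ ≠ s₃ ∧ s₁ ≠ s₄ ∧ s₂ ≠ s₃ ∧ s₂ ≠ s₄ ∧ s₃ ≠ s₄ ∧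
      IsLocalExtr (fun s => wedge (deriv σ s) (deriv (deriv σ) s)) s₁ ∧
      IsLocalExtr (fun s => wedge (deriv σ s) (deriv (deriv σ) s)) s₂ ∧
      IsLocalExtr (fun s => wedge (deriv σ s) (deriv (deriv σ) s)) s₃ ∧
      IsLocalExtr (fun s => wedge (deriv σ s) (deriv (deriv σ) s)) s₄ := by
  have hσ1 : ContDiff ℝ (⊤ : ℕ∞) (deriv σ) := (contDiff_infty_iff_deriv.1 hσ).2
  have hσ2 : ContDiff ℝ (⊤ : ℕ∞) (deriv (deriv σ)) := (contDiff_infty_iff_deriv.1 hσ1).2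
  have hcoord : ∀ {f : ℝ → EuclideanSpace ℝ (Fin 2)}, ContDiff ℝ (⊤ : ℕ∞) f → ∀ i s,
      HasDerivAt (fun s => f s i) (deriv f s i) s := fun hf i s =>
    (EuclideanSpace.proj (𝕜 := ℝ) i).hasFDerivAt.comp_hasDerivAt s
      ((hf.differentiable (by simp)) s).hasDerivAt
  have hperd : ∀ {f : ℝ → EuclideanSpace ℝ (Fin 2)}, Function.Periodic f L →
      Function.Periodic (deriv f) L := fun {f} hf s => by
    rw [← deriv_comp_add_const]
    exact congrArg (fun g => deriv g s) (funext hf)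
  have hper1 := hperd hper
  have hper2 := hperd hper1
  set k : ℝ → ℝ := fun s => wedge (deriv σ s) (deriv (deriv σ) s) with hk
  have hkd : Differentiable ℝ k := fun s =>
    (((hcoord hσ1 0 s).mul (hcoord hσ2 1 s)).sub
      ((hcoord hσ1 1 s).mul (hcoord hσ2 0 s))).differentiableAt
  have hkper : Function.Periodic k L := fun s => by simp only [hk, hper1 s, hper2 s]
  rcases exists_four_isLocalExtr_or_strictAntiOn_strictMonoOn hL hkd.continuous hkper with h | h
  · exact h
  obtain ⟨p, q, hpq, hqL, hA, hB⟩ := h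
  let toC : EuclideanSpace ℝ (Fin 2) → ℂ := fun v => v 0 + v 1 * Complex.I
  have toC_inj : Function.Injective toC := fun v w h => by
    ext i
    fin_cases i
    · simpa [toC] using congrArg Complex.re h
    · simpa [toC] using congrArg Complex.im h
  have toC_deriv : ∀ {f : ℝ → EuclideanSpace ℝ (Fin 2)}, ContDiff ℝ (⊤ : ℕ∞) f → ∀ s,
      HasDerivAt (fun s => toC (f s)) (toC (deriv f s)) s := fun hf s =>
    (hcoord hf 0 s).ofReal_comp.add ((hcoord hf 1 s).ofReal_comp.mul_const Complex.I)
  have hsq : ∀ s, deriv σ s 0 ^ 2 + deriv σ s 1 ^ 2 = 1 := fun s => by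
    have h := EuclideanSpace.real_norm_sq_eq (deriv σ s)
    rw [hunit s, Fin.sum_univ_two] at h
    linarith
  have horth : ∀ s, deriv σ s 0 * deriv (deriv σ) s 0 + deriv σ s 1 * deriv (deriv σ) s 1 = 0 := by
    intro s
    have h := ((hcoord hσ1 0 s).pow 2).add ((hcoord hσ1 1 s).pow 2)
    have h' : HasDerivAt (fun s => deriv σ s 0 ^ 2 + deriv σ s 1 ^ 2) 0 s := by
      simp only [hsq]
      exact hasDerivAt_const s 1
    have e := h.unique h'
    norm_num at e
    linarith
  refine absurd (fun x hx y hy hxy => hper.injOn_Ico hL hinj p hx hy (toC_inj hxy))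
    (not_injOn_of_strictAntiOn_strictMonoOn (z := fun s => toC (σ s))
      (T := fun s => toC (deriv σ s)) (toC_deriv hσ)
      (fun s => (toC_deriv hσ1 s).congr_deriv ?_) (fun s => (hkd s).hasDerivAt) (fun s h => ?_)
      (fun s => by simp only [hper s]) (fun s => by simp only [hper1 s]) hpq hqL hA hB)
  · apply Complex.ext
    · simp [toC, hk, wedge]
      linear_combination -deriv (deriv σ) s 0 * hsq s + deriv σ s 0 * horth s
    · simp [toC, hk, wedge]
      linear_combination -deriv (deriv σ) s 1 * hsq s + deriv σ s 1 * horth s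
  · have h0 : deriv σ s 0 = 0 := by simpa [toC] using congrArg Complex.re h
    have h1 : deriv σ s 1 = 0 := by simpa [toC] using congrArg Complex.im h
    have := hsq s
    rw [h0, h1] at this
    norm_num at this
end
end

section
/- Let S² = {x ∈ ℝ³ : ‖x‖ = 1} be the unit sphere in Euclidean ℝ³ and let v : S² → ℝ³ be a continuous map such that ⟨v(x), x⟩ = 0 for every x ∈ S². Then there exists x ∈ S² with v(x) = 0. -/
open scoped RealInnerProductSpace

noncomputable section

namespace HairyBall

/-- The unit sphere in Euclidean 3-space. -/
abbrev Sphere : Set (EuclideanSpace ℝ (Fin 3)) := Metric.sphere 0 1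

/-- Inverse stereographic projection from the pole `(0, 0, s)`, where `s = ± 1`. -/
def invStereo (s : ℝ) (hs : s ^ 2 = 1) (z : ℂ) : Sphere :=
  ⟨!₂[2 * z.re / (1 + (z.re ^ 2 + z.im ^ 2)), 2 * z.im / (1 + (z.re ^ 2 + z.im ^ 2)),
      s * (z.re ^ 2 + z.im ^ 2 - 1) / (1 + (z.re ^ 2 + z.im ^ 2))], by
    have h : 1 + (z.re ^ 2 + z.im ^ 2) ≠ 0 := by positivity
    rw [Sphere, EuclideanSpace.sphere_zero_eq _ zero_le_one]
    simp only [Set.mem_ofPred_eq, Fin.sum_univ_three, Matrix.cons_val, one_pow]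
    field_simp
    linear_combination ((z.re ^ 2 + z.im ^ 2 - 1) ^ 2) * hs⟩

lemma continuous_invStereo (s : ℝ) (hs : s ^ 2 = 1) : Continuous (invStereo s hs) := by
  refine Continuous.subtype_mk ((PiLp.continuous_toLp 2 _).comp (continuous_pi fun i ↦ ?_)) _
  have h (z : ℂ) : 1 + (z.re ^ 2 + z.im ^ 2) ≠ 0 := by positivity
  fin_cases i <;> simp <;> fun_prop (disch := exact h _)

lemma invStereo_eq_of_sq_add_sq (s : ℝ) (hs : s ^ 2 = 1) {z : ℂ} (hz : z.re ^ 2 + z.im ^ 2 = 1) :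
    (invStereo s hs z : EuclideanSpace ℝ (Fin 3)) = !₂[z.re, z.im, 0] := by
  ext i
  fin_cases i <;> simp [invStereo, hz] <;> ring

/-- A nowhere-zero continuous function on the plane has a continuous logarithm. -/
lemma exists_continuous_exp_eq {g : ℂ → ℂ} (hg : Continuous g) (h0 : ∀ z, g z ≠ 0) :
    ∃ F : ℂ → ℂ, Continuous F ∧ ∀ z, Complex.exp (F z) = g z := by
  obtain ⟨F, ⟨-, hF⟩, -⟩ := Complex.isCoveringMapOn_exp.existsUnique_continuousMap_lifts
    ⟨g, hg⟩ (a₀ := 0) (Complex.exp_log (h0 0)) h0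
  exact ⟨F, F.continuous, fun z ↦ congrFun hF z⟩

/-- A continuous function on the line with constant exponential is constant. -/
lemma eq_of_exp_eq_const {f : ℝ → ℂ} (hf : Continuous f) {c : ℂ}
    (h : ∀ t, Complex.exp (f t) = c) (a b : ℝ) : f a = f b :=
  Complex.isCoveringMap_exp.const_of_comp hf
    (fun a b ↦ Subtype.ext ((h a).trans (h b).symm)) a b

/-- Up to a positive factor, the expression of a tangent vector `w` at `invStereo s hs z` in the
stereographic chart. -/
def chartVector (s : ℝ) (z : ℂ) (w : EuclideanSpace ℝ (Fin 3)) : ℂ :=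
  ⟨w 0 + s * z.re * w 2, w 1 + s * z.im * w 2⟩

lemma eq_zero_of_chartVector_eq_zero {s : ℝ} (hs : s ^ 2 = 1) {z : ℂ}
    {w : EuclideanSpace ℝ (Fin 3)}
    (hw : ⟪w, (invStereo s hs z : EuclideanSpace ℝ (Fin 3))⟫ = 0)
    (h : chartVector s z w = 0) : w = 0 := by
  have hd : 1 + (z.re ^ 2 + z.im ^ 2) ≠ 0 := by positivity
  have h0 : w 0 + s * z.re * w 2 = 0 := congrArg Complex.re h
  have h1 : w 1 + s * z.im * w 2 = 0 := congrArg Complex.im h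
  simp only [invStereo, PiLp.inner_apply, Fin.sum_univ_three, RCLike.inner_apply, conj_trivial,
    Matrix.cons_val] at hw
  field_simp at hw
  have h2 : w 2 = 0 := by
    have : (1 + (z.re ^ 2 + z.im ^ 2)) * w 2 = 0 := by
      linear_combination (-s) * hw + 2 * s * z.re * h0 + 2 * s * z.im * h1
        - (1 + (z.re ^ 2 + z.im ^ 2)) * w 2 * hs
    simpa [hd] using this
  ext i
  fin_cases i <;> simp_all

/-- The chart expression of a nowhere-zero tangent field has a continuous logarithm. -/
lemma exists_log_chartVector {v : Sphere → EuclideanSpace ℝ (Fin 3)} (hv : Continuous v)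
    (htang : ∀ x, ⟪v x, (x : EuclideanSpace ℝ (Fin 3))⟫ = 0) (hne : ∀ x, v x ≠ 0)
    (s : ℝ) (hs : s ^ 2 = 1) :
    ∃ F : ℂ → ℂ, Continuous F ∧
      ∀ z, Complex.exp (F z) = chartVector s z (v (invStereo s hs z)) := by
  refine exists_continuous_exp_eq ?_ fun z h ↦
    hne _ (eq_zero_of_chartVector_eq_zero hs (htang _) h)
  have hc := hv.comp (continuous_invStereo s hs)
  have hi (i : Fin 3) : Continuous fun z ↦ v (invStereo s hs z) i :=
    (EuclideanSpace.proj (𝕜 := ℝ) i).continuous.comp hc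
  exact Complex.equivRealProdCLM.symm.continuous.comp <|
    ((hi 0).add ((continuous_const.mul Complex.continuous_re).mul (hi 2))).prodMk
      ((hi 1).add ((continuous_const.mul Complex.continuous_im).mul (hi 2)))

/-- On the equator the two stereographic chart expressions differ by a transition function of
degree two. -/
lemma conj_chartVector_mul_sq {z : ℂ} (hz : z.re ^ 2 + z.im ^ 2 = 1)
    {w : EuclideanSpace ℝ (Fin 3)} (hw : w 0 * z.re + w 1 * z.im = 0) :
    (starRingEnd ℂ) (chartVector (-1) z w) * z ^ 2 = -chartVector 1 z w := by
  apply Complex.ext <;> simp [chartVector, pow_two]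
  · linear_combination 2 * z.re * hw + (-w 0 - w 2 * z.re) * hz
  · linear_combination 2 * z.im * hw + (-w 1 - w 2 * z.im) * hz

end HairyBall

open HairyBall in
/-- hairy ball theorem: every continuous tangent vector field on the
unit sphere `S² ⊂ ℝ³` vanishes somewhere. -/
theorem hairy_ball
    (v : Metric.sphere (0 : EuclideanSpace ℝ (Fin 3)) 1 → EuclideanSpace ℝ (Fin 3))
    (hv : Continuous v)
    (htang : ∀ x, ⟪v x, (x : EuclideanSpace ℝ (Fin 3))⟫ = 0) :
    ∃ x, v x = 0 := by
  by_contra! hne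
  obtain ⟨F, hFc, hF⟩ := exists_log_chartVector hv htang hne 1 (by norm_num)
  obtain ⟨G, hGc, hG⟩ := exists_log_chartVector hv htang hne (-1) (by norm_num)
  let e : ℝ → ℂ := fun t ↦ Complex.exp (t * Complex.I)
  have he : Continuous e := by fun_prop
  let f : ℝ → ℂ := fun t ↦ (starRingEnd ℂ) (G (e t)) + 2 * (t * Complex.I) - F (e t)
  have hf : Continuous f := by fun_prop
  have hexp (t : ℝ) : Complex.exp (f t) = -1 := by
    have hz : (e t).re ^ 2 + (e t).im ^ 2 = 1 := by
      simp [e, Complex.exp_ofReal_mul_I_re, Complex.exp_ofReal_mul_I_im]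
    have hx : invStereo (-1) (by norm_num) (e t) = invStereo 1 (by norm_num) (e t) :=
      Subtype.ext <| by rw [invStereo_eq_of_sq_add_sq _ _ hz, invStereo_eq_of_sq_add_sq _ _ hz]
    have hw := htang (invStereo 1 (by norm_num) (e t))
    rw [invStereo_eq_of_sq_add_sq _ _ hz] at hw
    simp only [PiLp.inner_apply, Fin.sum_univ_three, RCLike.inner_apply, conj_trivial,
      Matrix.cons_val] at hw
    have key := conj_chartVector_mul_sq hz
      (w := v (invStereo 1 (by norm_num) (e t))) (by linear_combination hw)
    rw [← hF, ← hx, ← hG] at key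
    rw [Complex.exp_sub, Complex.exp_add, Complex.exp_conj,
      div_eq_iff (Complex.exp_ne_zero _), neg_one_mul, ← key, ← Nat.cast_ofNat (R := ℂ),
      Complex.exp_nat_mul]
  have h := eq_of_exp_eq_const hf hexp 0 (2 * Real.pi)
  simp [f, e, Complex.exp_two_pi_mul_I, Real.pi_ne_zero] at h
end
end
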